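/- Let G be a finitely generated group, E an admissible family of subgroups of G, and T a minimal E-tree with basepoint vertex v₀. If S and S' are infinite special forests such that X_S ∩ X_{S'} is small, then S and S' are equivalent (i.e., up to finite symmetric difference) to disjoint special forests. -/

import Mathlib

open scoped Pointwise symmDiff

namespace SSRN

section Group
variable {G : Type*} [Group G]

/-- A subset of `G` is `H`-finite if it is contained in finitely many orbits of the
action of `H` on `G` by left multiplication. -/
def HFin (H : Subgroup G) (X : Set G) : Prop :=
  ∃ F : Finset G, X ⊆ ⋃ f ∈ F, (· * f) '' (H : Set G)

/-- Two subsets of `G` are `H`-equivalent if their symmetric difference is `H`-finite. -/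
def AIEquiv (H : Subgroup G) (X Y : Set G) : Prop := HFin H (X ∆ Y)

/-- `X` is an `H`-almost invariant subset of `G`. -/
def IsAI (H : Subgroup G) (X : Set G) : Prop :=
  (∀ h ∈ H, (h * ·) '' X = X) ∧ ∀ s : G, HFin H (((· * s) '' X) ∆ X)

/-- `X` is a non-trivial `H`-almost invariant subset of `G`. -/
def NontrivAI (H : Subgroup G) (X : Set G) : Prop :=
  IsAI H X ∧ ¬ HFin H X ∧ ¬ HFin H Xᶜ

/-- The `H`-almost invariant set `X` crosses `Y`: none of the four corners is `H`-finite. -/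
def Crosses (H : Subgroup G) (X Y : Set G) : Prop :=
  ¬ HFin H (X ∩ Y) ∧ ¬ HFin H (X ∩ Yᶜ) ∧ ¬ HFin H (Xᶜ ∩ Y) ∧ ¬ HFin H (Xᶜ ∩ Yᶜ)

/-- Crossing of (non-trivial) almost invariant sets, quantifying over the groups over
which they are almost invariant. -/
def CrossesAny (X X' : Set G) : Prop :=
  ∃ H K : Subgroup G, NontrivAI H X ∧ NontrivAI K X' ∧ Crosses H X X'

/-- `X` and `X'` determine the same unordered pair `{[X], [X*]}` of equivalence classes. -/
def SamePair (X X' : Set G) : Prop :=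
  ∃ H : Subgroup G, NontrivAI H X ∧ (HFin H (X ∆ X') ∨ HFin H (X ∆ X'ᶜ))

/-- An admissible family of subgroups: conjugacy invariant, closed under commensurability,
and no member contains another with infinite index. -/
def Admissible (E : Set (Subgroup G)) : Prop :=
  (∀ H ∈ E, ∀ g : G, (MulAut.conj g • H) ∈ E) ∧
  (∀ H ∈ E, ∀ K : Subgroup G, Subgroup.Commensurable K H → K ∈ E) ∧
  (∀ A ∈ E, ∀ B ∈ E, A ≤ B → A.relIndex B ≠ 0)

end Group

section Tree

variable {V : Type*}

/-- The stabilizer of an edge `e : Sym2 V` under the action of `G`. -/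
def edgeStab (G : Type*) [Group G] [MulAction G V] (e : Sym2 V) : Subgroup G where
  carrier := {g | Sym2.map (g • ·) e = e}
  one_mem' := by
    show Sym2.map ((1 : G) • ·) e = e
    have : ((1 : G) • · : V → V) = id := by funext v; simp
    rw [this, Sym2.map_id]; rfl
  mul_mem' := by
    intro a b ha hb
    show Sym2.map ((a * b) • ·) e = e
    have : ((a * b) • · : V → V) = (a • ·) ∘ (b • ·) := by funext v; simp [mul_smul]
    rw [this, ← Sym2.map_map, hb, ha]
  inv_mem' := by
    intro a ha
    show Sym2.map (a⁻¹ • ·) e = e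
    conv_lhs => rw [← ha]
    rw [Sym2.map_map]
    have : ((a⁻¹ • ·) ∘ (a • ·) : V → V) = id := by funext v; simp
    rw [this, Sym2.map_id]; rfl

variable (T : SimpleGraph V)

/-- `G` acts on the graph `T` by graph automorphisms. -/
def ActsOn (G : Type*) [Group G] [MulAction G V] : Prop :=
  ∀ (g : G) (u v : V), T.Adj u v → T.Adj (g • u) (g • v)

/-- The action of `G` on `T` is without inversions. -/
def NoInversions (G : Type*) [Group G] [MulAction G V] : Prop :=
  ∀ (g : G) (u v : V), T.Adj u v → ¬ (g • u = v ∧ g • v = u)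

/-- `w` lies between `u` and `v`: it is on every path from `u` to `v`. -/
def Btw (u w v : V) : Prop := ∀ p : T.Walk u v, p.IsPath → w ∈ p.support

/-- The action of `G` on the tree `T` is minimal: every nonempty invariant subtree
(convex invariant set of vertices) is the whole vertex set. -/
def MinimalAction (G : Type*) [Group G] [MulAction G V] : Prop :=
  ∀ A : Set V, A.Nonempty → (∀ (g : G), ∀ a ∈ A, g • a ∈ A) →
    (∀ u ∈ A, ∀ v ∈ A, ∀ w : V, Btw T u w v → w ∈ A) → A = Set.univ

/-- The action of `G` is non-trivial: there is no global fixed vertex. -/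
def NontrivialAction (G : Type*) [Group G] [MulAction G V] : Prop :=
  ¬ ∃ v : V, ∀ g : G, g • v = v

/-- `T` is an `E`-tree: all edge stabilizers belong to `E`. -/
def IsETree (G : Type*) [Group G] [MulAction G V] (E : Set (Subgroup G)) : Prop :=
  ∀ e ∈ T.edgeSet, edgeStab G e ∈ E

/-- There are finitely many `G`-orbits of edges. -/
def FinEdgeOrbits (G : Type*) [Group G] [MulAction G V] : Prop :=
  ∃ F : Finset (Sym2 V), ∀ e ∈ T.edgeSet, ∃ e₀ ∈ F, ∃ g : G, Sym2.map (g • ·) e₀ = e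

/-- A cylinder of `T`: an equivalence class of edges for commensurability of stabilizers. -/
def IsCylinder (G : Type*) [Group G] [MulAction G V] (Y : Set (Sym2 V)) : Prop :=
  Y.Nonempty ∧ Y ⊆ T.edgeSet ∧
    ∀ e ∈ Y, ∀ e' ∈ T.edgeSet,
      (e' ∈ Y ↔ Subgroup.Commensurable (edgeStab G e) (edgeStab G (V := V) e'))

/-- The set of vertices of a set of edges (e.g. of a cylinder). -/
def cylVerts (Y : Set (Sym2 V)) : Set V := {v | ∃ e ∈ Y, v ∈ e}

/-- The boundary of a cylinder: its vertices lying in another cylinder,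
i.e. incident to an edge outside the cylinder. -/
def cylBoundary (Y : Set (Sym2 V)) : Set V :=
  {v | v ∈ cylVerts Y ∧ ∃ e ∈ T.edgeSet, v ∈ e ∧ e ∉ Y}

/-- `H` belongs to the commensurability class associated to the cylinder `Y`. -/
def InClassOf (G : Type*) [Group G] [MulAction G V] (Y : Set (Sym2 V)) (H : Subgroup G) : Prop :=
  ∃ e ∈ Y, Subgroup.Commensurable H (edgeStab G e)

/-- The coboundary of a set of vertices: edges with exactly one endpoint in it. -/
def cobdry (S : Set V) : Set (Sym2 V) :=
  {e | e ∈ T.edgeSet ∧ ∃ u v : V, e = s(u, v) ∧ u ∈ S ∧ v ∉ S}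

/-- `S` is a special forest based on the cylinder `Y`. -/
def IsSpecialForest (S : Set V) (Y : Set (Sym2 V)) : Prop :=
  (cobdry T S).Finite ∧ cobdry T S ⊆ Y

/-- A set of vertices is non-trivial if it is neither finite nor cofinite. -/
def NontrivForest (S : Set V) : Prop := ¬ S.Finite ∧ ¬ (Sᶜ : Set V).Finite

/-- The almost invariant set associated to a set of vertices. -/
def XS (G : Type*) [Group G] [MulAction G V] (v₀ : V) (S : Set V) : Set G :=
  {g : G | g • v₀ ∈ S}

/-- The component `T_e` of `T` minus the open edge `e = s(u,v)` containing the terminal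
vertex `v`. -/
def halfTree (u v : V) : Set V :=
  {w | ∃ p : T.Walk v w, p.IsPath ∧ s(u, v) ∉ p.edges}

/-- The almost invariant set `Z_e` dual to the oriented edge `(u, v)`. -/
def Ze (G : Type*) [Group G] [MulAction G V] (v₀ u v : V) : Set G :=
  XS G v₀ (halfTree T u v)

/-- `v` has finitely many incident edges in `Y`. -/
def FiniteValenceIn (Y : Set (Sym2 V)) (v : V) : Prop := {e | e ∈ Y ∧ v ∈ e}.Finite

/-- The peripheral special forest `S_{v,Y}`: the component of `v` in `T` minus the open
edges of `Y` incident to `v`. -/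
def periForest (Y : Set (Sym2 V)) (v : V) : Set V :=
  {w | ∃ p : T.Walk v w, p.IsPath ∧ ∀ e ∈ Y, v ∈ e → e ∉ p.edges}

/-- The peripheral almost invariant set `X_{v,Y}`. -/
def XvY (G : Type*) [Group G] [MulAction G V] (v₀ : V) (Y : Set (Sym2 V)) (v : V) : Set G :=
  XS G v₀ (periForest T Y v)

/-- A peripheral special forest: one equivalent to some `S_{v,Y}`. -/
def PeripheralForest (G : Type*) [Group G] [MulAction G V] (S : Set V) : Prop :=
  ∃ (Y : Set (Sym2 V)) (v : V), IsCylinder T G Y ∧ v ∈ cylBoundary T Y ∧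
    FiniteValenceIn Y v ∧ (S ∆ periForest T Y v).Finite

/-- The Boolean algebra `B_C(T)` of (representatives of) almost invariant sets based on the
cylinder `Y`: the smallest family containing the sets `Z_e`, `e ∈ Y`, closed under
complement, intersection and `H`-equivalence. -/
def BCT {G : Type*} [Group G] [MulAction G V] (v₀ : V) (Y : Set (Sym2 V)) (H : Subgroup G) :
    Set (Set G) :=
  ⋂₀ {F : Set (Set G) |
    (∀ u v : V, T.Adj u v → s(u, v) ∈ Y → Ze T G v₀ u v ∈ F) ∧
    (∀ X ∈ F, Xᶜ ∈ F) ∧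
    (∀ X ∈ F, ∀ X' ∈ F, X ∩ X' ∈ F) ∧
    (∀ X ∈ F, ∀ X' : Set G, HFin H (X ∆ X') → X' ∈ F)}

/-- The set `B(T)` of (representatives of) almost invariant sets based on `T`. -/
def BT (G : Type*) [Group G] [MulAction G V] (v₀ : V) : Set (Set G) :=
  {X | ∃ Y : Set (Sym2 V), IsCylinder T G Y ∧ ∃ e ∈ Y, X ∈ BCT T v₀ Y (edgeStab G e)}

/-- Elements of `B(T)` that are non-trivial almost invariant sets. -/
def NontrivB (G : Type*) [Group G] [MulAction G V] (v₀ : V) : Set (Set G) :=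
  {X | X ∈ BT T G v₀ ∧ ∃ H : Subgroup G, NontrivAI H X}

/-- One step of the relation generating cross-connected components. -/
def ccStep (G : Type*) [Group G] [MulAction G V] (v₀ : V) (X X' : Set G) : Prop :=
  X ∈ NontrivB T G v₀ ∧ X' ∈ NontrivB T G v₀ ∧ (CrossesAny X X' ∨ SamePair X X')

/-- The equivalence relation generated by crossing (and identification of equivalent sets
and complements) on `B(T)`. -/
def ccRel (G : Type*) [Group G] [MulAction G V] (v₀ : V) : Set G → Set G → Prop :=
  Relation.EqvGen (ccStep T G v₀)

/-- The cross-connected component of (the pair determined by) `X`. -/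
def ccOf (G : Type*) [Group G] [MulAction G V] (v₀ : V) (X : Set G) : Set (Set G) :=
  {X' | ccRel T G v₀ X X'}

/-- `C` is a cross-connected component of `B(T)`. -/
def IsCCC (G : Type*) [Group G] [MulAction G V] (v₀ : V) (C : Set (Set G)) : Prop :=
  ∃ X ∈ NontrivB T G v₀, C = ccOf T G v₀ X

/-- A cross-connected component is based on the cylinder `Y` if its members are almost
invariant over subgroups in the commensurability class of `Y`. -/
def CCCBasedOn (G : Type*) [Group G] [MulAction G V] (Y : Set (Sym2 V)) (C : Set (Set G)) :
    Prop :=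
  ∃ X ∈ C, ∃ H : Subgroup G, InClassOf G Y H ∧ NontrivAI H X

/-- A peripheral cross-connected component. -/
def PeripheralCCC (G : Type*) [Group G] [MulAction G V] (v₀ : V) (C : Set (Set G)) : Prop :=
  ∃ (Y : Set (Sym2 V)) (v : V), IsCylinder T G Y ∧ v ∈ cylBoundary T Y ∧
    FiniteValenceIn Y v ∧ XvY T G v₀ Y v ∈ C

/-- Betweenness of (distinct) cross-connected components. -/
def CCCBetween {G : Type*} [Group G] (C₁ C₂ C₃ : Set (Set G)) : Prop :=
  C₁ ≠ C₂ ∧ C₂ ≠ C₃ ∧ C₁ ≠ C₃ ∧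
    ∃ X₁ ∈ C₁, ∃ X₂ ∈ C₂, ∃ X₃ ∈ C₃, X₁ ⊆ X₂ ∧ X₂ ⊆ X₃

/-- A star of cross-connected components. -/
def IsStar (G : Type*) [Group G] [MulAction G V] (v₀ : V) (St : Set (Set (Set G))) : Prop :=
  (∀ C ∈ St, IsCCC T G v₀ C) ∧ St.Nontrivial ∧
  (∀ C ∈ St, ∀ C' ∈ St, ∀ C'' : Set (Set G), IsCCC T G v₀ C'' → ¬ CCCBetween C C'' C') ∧
  (∀ St' : Set (Set (Set G)), St ⊆ St' → (∀ C ∈ St', IsCCC T G v₀ C) →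
    (∀ C ∈ St', ∀ C' ∈ St', ∀ C'' : Set (Set G), IsCCC T G v₀ C'' → ¬ CCCBetween C C'' C') →
    St' = St)

/-- The regular neighbourhood `RN(B(T))`: the bipartite graph on cross-connected
components and stars. -/
def RNGraph (G : Type*) [Group G] [MulAction G V] (v₀ : V) :
    SimpleGraph ({C : Set (Set G) // IsCCC T G v₀ C} ⊕
      {St : Set (Set (Set G)) // IsStar T G v₀ St}) where
  Adj x y :=
    match x, y with
    | Sum.inl C, Sum.inr St => C.1 ∈ St.1
    | Sum.inr St, Sum.inl C => C.1 ∈ St.1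
    | _, _ => False
  symm := ⟨by rintro (C | St) (C' | St') h <;> exact h⟩
  loopless := ⟨by rintro (C | St) h <;> exact h⟩

/-- Vertices of `T` lying in at least two cylinders. -/
def TcV0 (G : Type*) [Group G] [MulAction G V] : Set V :=
  {v | ∃ Y Y' : Set (Sym2 V), IsCylinder T G Y ∧ IsCylinder T G Y' ∧ Y ≠ Y' ∧
    v ∈ cylVerts Y ∧ v ∈ cylVerts Y'}

/-- The tree of cylinders `T_c` of `T`, as a bipartite graph. -/
def TcGraph (G : Type*) [Group G] [MulAction G V] :
    SimpleGraph ({v : V // v ∈ TcV0 T G} ⊕ {Y : Set (Sym2 V) // IsCylinder T G Y}) where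
  Adj x y :=
    match x, y with
    | Sum.inl v, Sum.inr Y => v.1 ∈ cylVerts Y.1
    | Sum.inr Y, Sum.inl v => v.1 ∈ cylVerts Y.1
    | _, _ => False
  symm := ⟨by rintro (v | Y) (v' | Y') h <;> exact h⟩
  loopless := ⟨by rintro (v | Y) h <;> exact h⟩


/-- `T` dominates `T'`: there is a `G`-equivariant map. -/
def Dominates (G : Type*) [Group G] {V V' : Type*} [MulAction G V] [MulAction G V']
    (T : SimpleGraph V) (T' : SimpleGraph V') : Prop :=
  ∃ f : V → V', ∀ (g : G) (x : V), f (g • x) = g • f x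

end Tree

section Subdiv

variable {α β : Type*}

/-- `S` is a subdivision of `Γ` via the vertex embedding `f`. -/
def SubdivVia (f : α → β) (S : SimpleGraph β) (Γ : SimpleGraph α) : Prop :=
  Function.Injective f ∧
  (∀ b : β, b ∉ Set.range f → ∃ x y : β, x ≠ y ∧ S.neighborSet b = {x, y}) ∧
  (∀ u : α, Nonempty (Γ.neighborSet u ≃ S.neighborSet (f u))) ∧
  (∀ u v : α, Γ.Adj u v ↔ ∃ p : S.Walk (f u) (f v), p.IsPath ∧ 1 ≤ p.length ∧
      ∀ w ∈ p.support, w ∈ Set.range f → w = f u ∨ w = f v) ∧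
  (∀ e ∈ S.edgeSet, ∃ (u v : α) (p : S.Walk (f u) (f v)), Γ.Adj u v ∧ p.IsPath ∧
      (∀ w ∈ p.support, w ∈ Set.range f → w = f u ∨ w = f v) ∧ e ∈ p.edges)

/-- `S` is (isomorphic to) a subdivision of `Γ`. -/
def IsSubdivision (S : SimpleGraph β) (Γ : SimpleGraph α) : Prop :=
  ∃ f : α → β, SubdivVia f S Γ

end Subdiv

end SSRN

namespace SSRN

section Helpers

variable {G V : Type*} [Group G] [MulAction G V] {T : SimpleGraph V}

theorem closed_eq_univ (hc : T.Connected) {A : Set V} (hne : A.Nonempty)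
    (hA : ∀ u ∈ A, ∀ v, T.Adj u v → v ∈ A) : A = Set.univ := by
  obtain ⟨a, ha⟩ := hne
  have key : ∀ u v (p : T.Walk u v), u ∈ A → v ∈ A := by
    intro u v p
    induction p with
    | nil => exact id
    | cons h p ih => exact fun hu => ih (hA _ hu _ h)
  ext x
  obtain ⟨p⟩ := hc.preconnected a x
  simp [key a x p ha]

theorem mem_of_walk {S : Set V} : ∀ {u v : V} (p : T.Walk u v),
    (∀ e ∈ p.edges, e ∉ cobdry T S) → u ∈ S → v ∈ S := by
  intro u v p
  induction p with
  | nil => exact fun _ h => h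
  | @cons a b c h p ih =>
    intro he ha
    refine ih (fun e hep => he e (by simp [hep])) ?_
    by_contra hb
    exact he s(a, b) (by simp) ⟨h, a, b, rfl, ha, hb⟩

theorem mem_cobdry {S : Set V} {u v : V} (h : T.Adj u v) (hu : u ∈ S) (hv : v ∉ S) :
    s(u, v) ∈ cobdry T S := ⟨h, u, v, rfl, hu, hv⟩

/-- The graph homomorphism given by a group element. -/
def actHom (hact : ActsOn T G) (g : G) : T →g T where
  toFun := fun x => g • x
  map_rel' := fun h => hact g _ _ h

theorem dist_smul_le (hT : T.IsTree) (hact : ActsOn T G) (g : G) (x y : V) :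
    T.dist (g • x) (g • y) ≤ T.dist x y := by
  obtain ⟨p, hp⟩ := hT.connected.exists_walk_length_eq_dist x y
  rw [← hp, ← SimpleGraph.Walk.length_map (actHom hact g) p]
  exact SimpleGraph.dist_le (p.map (actHom hact g))

theorem dist_smul (hT : T.IsTree) (hact : ActsOn T G) (g : G) (x y : V) :
    T.dist (g • x) (g • y) = T.dist x y := by
  apply le_antisymm (dist_smul_le hT hact g x y)
  have := dist_smul_le hT hact g⁻¹ (g • x) (g • y)
  simpa using this

theorem relIndex_stab (K : Subgroup G) (w : V) :
    (MulAction.stabilizer G w).relIndex K ≠ 0 ↔ (MulAction.orbit K w).Finite := by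
  have h : (MulAction.stabilizer G w).relIndex K = (MulAction.orbit K w).ncard := by
    rw [← MulAction.index_stabilizer]
    rfl
  rw [h]
  constructor
  · exact Set.finite_of_ncard_ne_zero
  · intro hf h0
    rw [Set.ncard_eq_zero hf] at h0
    exact (MulAction.nonempty_orbit (M := K) w).ne_empty h0

theorem edgeStab_eq (hinv : NoInversions T G) {u v : V} (h : T.Adj u v) :
    edgeStab G s(u, v) = MulAction.stabilizer G u ⊓ MulAction.stabilizer G v := by
  ext g
  have : g ∈ edgeStab G s(u, v) ↔ s(g • u, g • v) = s(u, v) := Iff.rfl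
  rw [this, Sym2.eq_iff, Subgroup.mem_inf, MulAction.mem_stabilizer_iff,
    MulAction.mem_stabilizer_iff]
  constructor
  · rintro (h1 | h1)
    · exact h1
    · exact absurd h1 (hinv g u v h)
  · exact Or.inl

theorem edgeStab_le (hinv : NoInversions T G) {e : Sym2 V} (he : e ∈ T.edgeSet) {v : V}
    (hv : v ∈ e) : edgeStab G e ≤ MulAction.stabilizer G v := by
  induction e with
  | h a b =>
    rw [edgeStab_eq hinv he]
    rcases Sym2.mem_iff.1 hv with rfl | rfl
    · exact inf_le_left
    · exact inf_le_right

theorem exists_adj_of_mem {e : Sym2 V} (he : e ∈ T.edgeSet) {v : V}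
    (hv : v ∈ e) : ∃ w, T.Adj v w ∧ e = s(v, w) := by
  obtain ⟨w, rfl⟩ := hv
  exact ⟨w, he, rfl⟩

/-- Edges at a vertex of finite valence have commensurable stabilizers. -/
theorem comm_of_finite_valence (hact : ActsOn T G) (hinv : NoInversions T G) {v : V}
    (hf : (T.neighborSet v).Finite) {e f : Sym2 V} (he : e ∈ T.edgeSet) (hf' : f ∈ T.edgeSet)
    (hve : v ∈ e) (hvf : v ∈ f) :
    Subgroup.Commensurable (edgeStab G e) (edgeStab G f) := by
  have main : ∀ e f : Sym2 V, e ∈ T.edgeSet → f ∈ T.edgeSet → v ∈ e → v ∈ f →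
      (edgeStab G e).relIndex (edgeStab G f) ≠ 0 := by
    intro e f he hf' hve hvf
    obtain ⟨w, hw, rfl⟩ := exists_adj_of_mem he hve
    have hle := edgeStab_le hinv hf' hvf
    rw [edgeStab_eq hinv hw]
    have orb : ∀ x, x = v ∨ x = w → (MulAction.orbit (edgeStab G f) x).Finite := by
      rintro x (rfl | rfl)
      · apply (Set.finite_singleton x).subset
        rintro _ ⟨⟨g, hg⟩, rfl⟩
        exact hle hg
      · apply hf.subset
        rintro _ ⟨⟨g, hg⟩, rfl⟩
        have := hact g _ _ hw
        rwa [show g • v = v from hle hg] at this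
    exact Subgroup.relIndex_inf_ne_zero ((relIndex_stab _ _).2 (orb v (Or.inl rfl)))
      ((relIndex_stab _ _).2 (orb w (Or.inr rfl)))
  exact ⟨main e f he hf' hve hvf, main f e hf' he hvf hve⟩

theorem cyl_disjoint {Y Y' : Set (Sym2 V)} (hY : IsCylinder T G Y) (hY' : IsCylinder T G Y')
    (hne : Y ≠ Y') : ∀ f ∈ Y, f ∉ Y' := by
  intro f hf hf'
  apply hne
  ext e
  constructor
  · intro he
    exact (hY'.2.2 f hf' e (hY.2.1 he)).2 ((hY.2.2 f hf e (hY.2.1 he)).1 he)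
  · intro he
    exact (hY.2.2 f hf e (hY'.2.1 he)).2 ((hY'.2.2 f hf' e (hY'.2.1 he)).1 he)

theorem map_eq_self_mem {α : Type*} (f : α → α) : ∀ l : List α, l.map f = l → ∀ x ∈ l, f x = x
  | [], _, _, hx => by simp at hx
  | a :: l, h, x, hx => by
    simp only [List.map_cons, List.cons.injEq] at h
    rcases List.mem_cons.1 hx with rfl | hx
    · exact h.1
    · exact map_eq_self_mem f l h.2 x hx

theorem fix_path (hT : T.IsTree) (hact : ActsOn T G) {u v : V} (p : T.Walk u v) (hp : p.IsPath)
    (g : G) (hu : g • u = u) (hv : g • v = v) : ∀ e ∈ p.edges, Sym2.map (g • ·) e = e := by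
  have hinj : Function.Injective (actHom hact g) := MulAction.injective g
  have hu' : actHom hact g u = u := hu
  have hv' : actHom hact g v = v := hv
  have hq : ((p.map (actHom hact g)).copy hu' hv').IsPath := by
    rw [SimpleGraph.Walk.isPath_copy]
    exact SimpleGraph.Walk.map_isPath_of_injective hinj hp
  have heq := (hT.existsUnique_path u v).unique hq hp
  have h2 := congrArg SimpleGraph.Walk.edges heq
  rw [SimpleGraph.Walk.edges_copy, SimpleGraph.Walk.edges_map] at h2
  exact map_eq_self_mem _ _ h2

/-- Cylinders are subtrees. -/
theorem cyl_path (hT : T.IsTree) (hact : ActsOn T G) (hinv : NoInversions T G)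
    {E : Set (Subgroup G)} (hE : Admissible E) (hET : IsETree T G E)
    {Y : Set (Sym2 V)} (hY : IsCylinder T G Y) {u v : V} (hu : u ∈ cylVerts Y)
    (hv : v ∈ cylVerts Y) (p : T.Walk u v) (hp : p.IsPath) : ∀ f ∈ p.edges, f ∈ Y := by
  intro f hf
  obtain ⟨e, he, hue⟩ := hu
  obtain ⟨e', he', hve⟩ := hv
  have hfe : f ∈ T.edgeSet := p.edges_subset_edgeSet hf
  have hc := (hY.2.2 e he e' (hY.2.1 he')).1 he'
  have hA : Subgroup.Commensurable (edgeStab G e ⊓ edgeStab G e') (edgeStab G e) := by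
    refine ⟨Subgroup.relIndex_inf_ne_zero (by simp) hc.2, ?_⟩
    rw [Subgroup.relIndex_eq_one.2 inf_le_left]
    exact one_ne_zero
  have hAE := hE.2.1 _ (hET e (hY.2.1 he)) _ hA
  have hle : edgeStab G e ⊓ edgeStab G e' ≤ edgeStab G f := by
    intro g hg
    exact fix_path hT hact p hp g (edgeStab_le hinv (hY.2.1 he) hue hg.1)
      (edgeStab_le hinv (hY.2.1 he') hve hg.2) f hf
  have hi := hE.2.2 _ hAE _ (hET f hfe) hle
  have hAf : Subgroup.Commensurable (edgeStab G e ⊓ edgeStab G e') (edgeStab G f) := by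
    refine ⟨hi, ?_⟩
    rw [Subgroup.relIndex_eq_one.2 hle]
    exact one_ne_zero
  exact (hY.2.2 e he f hfe).2 (hA.symm.trans hAf)

theorem cyl_const (hT : T.IsTree) (hact : ActsOn T G) (hinv : NoInversions T G)
    {E : Set (Subgroup G)} (hE : Admissible E) (hET : IsETree T G E)
    {Y Y' : Set (Sym2 V)} (hY : IsCylinder T G Y) (hY' : IsCylinder T G Y')
    (hne : Y ≠ Y') {S : Set V} (hS : IsSpecialForest T S Y) :
    (∀ v ∈ cylVerts Y', v ∈ S) ∨ (∀ v ∈ cylVerts Y', v ∉ S) := by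
  by_contra! hcon
  obtain ⟨⟨v, hv, hvS⟩, u, hu, huS⟩ := hcon
  obtain ⟨p, hp, -⟩ := hT.existsUnique_path u v
  apply hvS
  refine mem_of_walk p (fun e he hc => ?_) huS
  exact cyl_disjoint hY hY' hne e (hS.2 hc) (cyl_path hT hact hinv hE hET hY' hu hv p hp e he)

/-- Cocompactness. -/
theorem cocompact (hGfg : Group.FG G) (hT : T.IsTree) (hact : ActsOn T G)
    (hmin : MinimalAction T G) (v₀ : V) : ∃ R : ℕ, ∀ x : V, ∃ g : G, T.dist x (g • v₀) ≤ R := by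
  classical
  obtain ⟨F, hF⟩ := hGfg.out
  set R := F.sup (fun s => T.dist v₀ (s • v₀)) with hR
  refine ⟨R, ?_⟩
  set A : Set V := {x | ∃ g : G, T.dist x (g • v₀) ≤ R} with hA
  have hAinv : ∀ (g : G), ∀ a ∈ A, g • a ∈ A := by
    rintro g a ⟨h, hh⟩
    refine ⟨g * h, ?_⟩
    rwa [mul_smul, dist_smul hT hact]
  let P : V → V → Prop := fun x y => ∃ p : T.Walk x y, ∀ z ∈ p.support, z ∈ A
  have Psymm : ∀ {x y}, P x y → P y x := by
    rintro x y ⟨p, hp⟩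
    exact ⟨p.reverse, fun z hz => hp z (by simpa using hz)⟩
  have Ptrans : ∀ {x y z}, P x y → P y z → P x z := by
    rintro x y z ⟨p, hp⟩ ⟨q, hq⟩
    refine ⟨p.append q, fun w hw => ?_⟩
    rcases (SimpleGraph.Walk.mem_support_append_iff p q).1 hw with h | h
    · exact hp w h
    · exact hq w h
  have Psmul : ∀ (g : G) {x y}, P x y → P (g • x) (g • y) := by
    rintro g x y ⟨p, hp⟩
    refine ⟨p.map (actHom hact g), fun w hw => ?_⟩
    have hw' := hw
    erw [SimpleGraph.Walk.support_map, List.mem_map] at hw'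
    obtain ⟨z, hz, rfl⟩ := hw'
    exact hAinv g z (hp z hz)
  have Pnear : ∀ (g : G) (x : V), T.dist x (g • v₀) ≤ R → P x (g • v₀) := by
    intro g x hx
    obtain ⟨p, hp⟩ := hT.connected.exists_walk_length_eq_dist x (g • v₀)
    refine ⟨p, fun z hz => ⟨g, ?_⟩⟩
    have h1 := SimpleGraph.dist_le (p.dropUntil z hz)
    have h2 := p.length_dropUntil_le_length hz
    omega
  have Pbase : ∀ g : G, P v₀ (g • v₀) := by
    intro g
    have hg : g ∈ Subgroup.closure (F : Set G) := by rw [hF]; trivial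
    induction hg using Subgroup.closure_induction with
    | mem s hs =>
      apply Pnear
      exact Finset.le_sup (f := fun s => T.dist v₀ (s • v₀)) hs
    | one => exact Pnear 1 _ (by simp)
    | mul a b _ _ ha hb =>
      rw [mul_smul]
      exact Ptrans ha (Psmul a hb)
    | inv a _ ha =>
      have := Psmul a⁻¹ ha
      rw [inv_smul_smul] at this
      exact Psymm this
  have hconv : ∀ u ∈ A, ∀ v ∈ A, ∀ w : V, Btw T u w v → w ∈ A := by
    rintro u ⟨g, hg⟩ v ⟨h, hh⟩ w hw
    have : P u v := Ptrans (Ptrans (Pnear g u hg) (Psymm (Pbase g)))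
      (Ptrans (Pbase h) (Psymm (Pnear h v hh)))
    obtain ⟨p, hp⟩ := this
    exact hp w (p.support_bypass_subset_support (hw p.bypass p.bypass_isPath))
  have huniv := hmin A ⟨v₀, 1, by simp⟩ hAinv hconv
  intro x
  have : x ∈ A := by rw [huniv]; trivial
  exact this

/-- No terminal vertices. -/
theorem no_leaves (hT : T.IsTree) (hact : ActsOn T G)
    (hmin : MinimalAction T G) (hinf : (Set.univ : Set V).Infinite) :
    ∀ x : V, ∃ a b, a ≠ b ∧ T.Adj x a ∧ T.Adj x b := by
  classical
  set A : Set V := {x | ∃ a b, a ≠ b ∧ T.Adj x a ∧ T.Adj x b} with hA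
  have hne : A.Nonempty := by
    by_contra hemp
    have huniq : ∀ x a b, T.Adj x a → T.Adj x b → a = b := by
      intro x a b ha hb
      by_contra hab
      exact hemp ⟨x, a, b, hab, ha, hb⟩
    obtain ⟨u, -⟩ := hinf.nonempty
    have h1 : insert u (T.neighborSet u) = Set.univ := by
      apply closed_eq_univ hT.connected ⟨u, by simp⟩
      rintro x (rfl | hx) v hv
      · exact Or.inr hv
      · exact Or.inl (huniq x v u hv hx.symm)
    apply hinf
    rw [← h1]
    apply Set.Finite.insert
    exact Set.Subsingleton.finite (fun a ha b hb => huniq u a b ha hb)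
  have hinvA : ∀ (g : G), ∀ a ∈ A, g • a ∈ A := by
    rintro g x ⟨a, b, hab, ha, hb⟩
    exact ⟨g • a, g • b, fun h => hab (MulAction.injective g h), hact g _ _ ha, hact g _ _ hb⟩
  have hconv : ∀ u ∈ A, ∀ v ∈ A, ∀ w : V, Btw T u w v → w ∈ A := by
    intro u hu v hv w hw
    by_cases hwu : w = u
    · rwa [hwu]
    by_cases hwv : w = v
    · rwa [hwv]
    obtain ⟨p, hp, -⟩ := hT.existsUnique_path u v
    have hwp := hw p hp
    obtain ⟨q, r, rfl⟩ := SimpleGraph.Walk.mem_support_iff_exists_append.1 hwp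
    have hqn : ¬ q.Nil := fun h => hwu h.eq.symm
    have hrn : ¬ r.Nil := fun h => hwv h.eq
    refine ⟨q.penultimate, r.snd, ?_, (q.adj_penultimate hqn).symm, r.adj_snd hrn⟩
    intro heq
    have h1 : q.penultimate ∈ q.support := q.getVert_mem_support _
    exact hp.disjoint_support_of_append hrn h1 (by
      rw [heq]; exact r.tail.start_mem_support)
  have huniv := hmin A hne hinvA hconv
  intro x
  have : x ∈ A := by rw [huniv]; trivial
  exact this

theorem exists_child (hT : T.IsTree) (hnl : ∀ x : V, ∃ a b, a ≠ b ∧ T.Adj x a ∧ T.Adj x b)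
    (u x : V) : ∃ c, T.Adj x c ∧ T.dist u c = T.dist u x + 1 := by
  by_contra! hcon
  obtain ⟨a, b, hab, ha, hb⟩ := hnl x
  have da := (hT.dist_eq_dist_add_one_of_adj u ha).resolve_right (hcon a ha)
  have db := (hT.dist_eq_dist_add_one_of_adj u hb).resolve_right (hcon b hb)
  obtain ⟨p, hp⟩ := hT.connected.exists_walk_length_eq_dist u a
  obtain ⟨q, hq⟩ := hT.connected.exists_walk_length_eq_dist u b
  have hp' : (p.concat ha.symm).IsPath := by
    apply SimpleGraph.Walk.isPath_of_length_eq_dist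
    rw [SimpleGraph.Walk.length_concat]; omega
  have hq' : (q.concat hb.symm).IsPath := by
    apply SimpleGraph.Walk.isPath_of_length_eq_dist
    rw [SimpleGraph.Walk.length_concat]; omega
  have heq := (hT.existsUnique_path u x).unique hp' hq'
  have := congrArg SimpleGraph.Walk.penultimate heq
  simp at this
  exact hab this

/-- A set with finite coboundary within bounded distance of `u` is finite. -/
theorem finite_of_bounded (hT : T.IsTree)
    (hnl : ∀ x : V, ∃ a b, a ≠ b ∧ T.Adj x a ∧ T.Adj x b)
    {C : Set V} (hC : (cobdry T C).Finite) (u : V) (N : ℕ) (hN : ∀ x ∈ C, T.dist u x ≤ N) :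
    C.Finite := by
  classical
  set B : Set V := {b | ∃ e ∈ cobdry T C, b ∈ e} with hB
  have hBf : B.Finite := by
    have : B = ⋃ e ∈ cobdry T C, {b | b ∈ e} := by ext; simp [hB]
    rw [this]
    apply hC.biUnion
    intro e _
    induction e with
    | h a b =>
      apply (Set.toFinite {a, b}).subset
      intro x hx
      simpa using hx
  set W : Set V := {w | ∃ b ∈ B, T.dist u w + T.dist w b = T.dist u b} with hW
  have hWf : W.Finite := by
    have : W = ⋃ b ∈ B, {w | T.dist u w + T.dist w b = T.dist u b} := by ext; simp [hW]
    rw [this]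
    apply hBf.biUnion
    intro b _
    obtain ⟨p, hp, -⟩ := hT.existsUnique_path u b
    apply (List.finite_toSet p.support).subset
    intro w hw
    obtain ⟨q, hq⟩ := hT.connected.exists_walk_length_eq_dist u w
    obtain ⟨r, hr⟩ := hT.connected.exists_walk_length_eq_dist w b
    have hqr : (q.append r).IsPath := by
      apply SimpleGraph.Walk.isPath_of_length_eq_dist
      rw [SimpleGraph.Walk.length_append, hq, hr]; exact hw
    have := (hT.existsUnique_path u b).unique hp hqr
    rw [this]
    show w ∈ (q.append r).support
    rw [SimpleGraph.Walk.mem_support_append_iff]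
    exact Or.inl q.end_mem_support
  apply hWf.subset
  have key : ∀ n : ℕ, ∀ x ∈ C, N ≤ T.dist u x + n → x ∈ W := by
    have hstep : ∀ x ∈ C, (∀ c ∈ C, T.dist u c = T.dist u x + 1 → c ∈ W) → x ∈ W := by
      intro x hx hch
      obtain ⟨c, hc, hd⟩ := exists_child hT hnl u x
      by_cases hcC : c ∈ C
      · obtain ⟨b, hb, hbd⟩ := hch c hcC hd
        refine ⟨b, hb, ?_⟩
        have h1 := hT.connected.dist_triangle (u := x) (v := c) (w := b)
        have h2 := hT.connected.dist_triangle (u := u) (v := x) (w := b)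
        have h3 := SimpleGraph.dist_eq_one_iff_adj.2 hc
        omega
      · exact ⟨x, ⟨s(x, c), mem_cobdry hc hx hcC, by simp⟩, by simp⟩
    intro n
    induction n with
    | zero =>
      intro x hx hNx
      apply hstep x hx
      intro c hc hd
      have := hN c hc
      omega
    | succ n ih =>
      intro x hx hNx
      apply hstep x hx
      intro c hc hd
      exact ih c hc (by omega)
  intro x hx
  exact key N x hx (by omega)

theorem finite_of_orbit_bounded (hT : T.IsTree)
    (hnl : ∀ x : V, ∃ a b, a ≠ b ∧ T.Adj x a ∧ T.Adj x b) (v₀ : V)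
    {R : ℕ} (hR : ∀ x : V, ∃ g : G, T.dist x (g • v₀) ≤ R)
    {C : Set V} (hC : (cobdry T C).Finite) (u : V) (N : ℕ)
    (hN : ∀ g : G, g • v₀ ∈ C → T.dist u (g • v₀) ≤ N) :
    C.Finite := by
  classical
  obtain ⟨M, hM⟩ : ∃ M : ℕ, ∀ e ∈ cobdry T C, ∀ b ∈ e, T.dist u b ≤ M := by
    have hb : ∀ e : Sym2 V, ∃ M : ℕ, ∀ b ∈ e, T.dist u b ≤ M := by
      intro e
      induction e with
      | h a b =>
        refine ⟨max (T.dist u a) (T.dist u b), fun x hx => ?_⟩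
        rcases Sym2.mem_iff.1 hx with rfl | rfl
        · exact le_max_left _ _
        · exact le_max_right _ _
    choose m hm using hb
    refine ⟨hC.toFinset.sup m, fun e he b hbe => (hm e b hbe).trans ?_⟩
    exact Finset.le_sup (hC.mem_toFinset.2 he)
  apply finite_of_bounded hT hnl hC u (N + M + R)
  intro x hx
  by_contra! hlt
  obtain ⟨g, hg⟩ := hR x
  obtain ⟨p, hp⟩ := hT.connected.exists_walk_length_eq_dist x (g • v₀)
  have hmem : g • v₀ ∈ C := by
    refine mem_of_walk p (fun e he hc => ?_) hx
    induction e with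
    | h a b =>
      have ha : a ∈ p.support := p.fst_mem_support_of_mem_edges he
      have h1 := hM _ hc a (by simp)
      have h2 := SimpleGraph.dist_le (p.takeUntil a ha)
      have h3 := p.length_takeUntil_le_length ha
      have h4 := hT.connected.dist_triangle (u := u) (v := a) (w := x)
      rw [SimpleGraph.dist_comm (u := a)] at h4
      omega
  have h1 := hN g hmem
  have h2 := hT.connected.dist_triangle (u := u) (v := g • v₀) (w := x)
  rw [SimpleGraph.dist_comm (u := g • v₀)] at h2
  omega

theorem bounded_of_HFin (hT : T.IsTree) (hact : ActsOn T G) (hinv : NoInversions T G) (v₀ : V)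
    {Y : Set (Sym2 V)} (hY : IsCylinder T G Y) {H : Subgroup G} (hH : InClassOf G Y H)
    {X : Set G} (hX : HFin H X) :
    ∃ (u : V) (N : ℕ), ∀ g ∈ X, T.dist u (g • v₀) ≤ N := by
  classical
  obtain ⟨e, he, hc⟩ := hH
  obtain ⟨F, hF⟩ := hX
  have heT := hY.2.1 he
  induction e with
  | h a b =>
    have hfin : (MulAction.orbit H a).Finite := by
      apply (relIndex_stab H a).1
      have hle := edgeStab_le hinv heT (Sym2.mem_mk_left a b)
      exact fun h0 => hc.2 (Nat.eq_zero_of_zero_dvd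
        (h0 ▸ Subgroup.relIndex_dvd_of_le_left H hle))
    refine ⟨a, (hfin.toFinset ×ˢ F).sup (fun q => T.dist q.1 (q.2 • v₀)), ?_⟩
    intro g hg
    have := hF hg
    simp only [Set.mem_iUnion, Set.mem_image] at this
    obtain ⟨f, hf, h, hh, rfl⟩ := this
    have heq : T.dist a ((h * f) • v₀) = T.dist (h⁻¹ • a) (f • v₀) := by
      rw [← dist_smul hT hact h (h⁻¹ • a), smul_inv_smul, mul_smul]
    rw [heq]
    refine Finset.le_sup (f := fun q : V × G => T.dist q.1 (q.2 • v₀)) (b := (h⁻¹ • a, f)) ?_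
    rw [Finset.mem_product, hfin.mem_toFinset]
    exact ⟨⟨⟨h⁻¹, H.inv_mem hh⟩, rfl⟩, hf⟩

theorem cobdry_inter (S S' : Set V) : cobdry T (S ∩ S') ⊆ cobdry T S ∪ cobdry T S' := by
  rintro _ ⟨h, u, v, rfl, hu, hv⟩
  by_cases hvS : v ∈ S
  · exact Or.inr (mem_cobdry h hu.2 fun h' => hv ⟨hvS, h'⟩)
  · exact Or.inl (mem_cobdry h hu.1 hvS)

theorem cobdry_diff (S S' : Set V) : cobdry T (S \ S') ⊆ cobdry T S ∪ cobdry T S' := by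
  rintro _ ⟨h, u, v, rfl, hu, hv⟩
  by_cases hvS : v ∈ S
  · refine Or.inr ?_
    rw [Sym2.eq_swap]
    exact mem_cobdry (SimpleGraph.Adj.symm h) (by by_contra h'; exact hv ⟨hvS, h'⟩) hu.2
  · exact Or.inl (mem_cobdry h hu.1 hvS)

/-- The nested case is impossible. -/
theorem case_nested (hT : T.IsTree) {Y Y' : Set (Sym2 V)} {S S' : Set V}
    (hS : IsSpecialForest T S Y) (hS' : IsSpecialForest T S' Y')
    (hSi : S.Infinite) (hS'i : S'.Infinite) (hfin : (S ∩ S').Finite)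
    (h1 : ∀ v ∈ cylVerts Y', v ∈ S) (h2 : ∀ v ∈ cylVerts Y, v ∉ S') : False := by
  by_cases hne : (S' \ S).Nonempty
  · have := closed_eq_univ hT.connected hne (by
      rintro u ⟨hu', hu⟩ v hv
      have hv' : v ∈ S' := by
        by_contra hv'
        exact hu (h1 u ⟨s(u, v), hS'.2 (mem_cobdry hv hu' hv'), by simp⟩)
      refine ⟨hv', fun hvS => ?_⟩
      exact h2 u ⟨s(v, u), hS.2 (mem_cobdry hv.symm hvS hu), by simp⟩ hu')
    obtain ⟨x, hx⟩ := hSi.nonempty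
    have hx' : x ∈ S' \ S := by rw [this]; trivial
    exact hx'.2 hx
  · apply hS'i
    apply hfin.subset
    intro x hx
    refine ⟨?_, hx⟩
    by_contra hxS
    exact hne ⟨x, hx, hxS⟩

end Helpers

/-- Infinite special forests with small intersection of the associated
almost invariant sets are equivalent to disjoint special forests. -/
theorem stmt_7 {G V : Type*} [Group G] [MulAction G V]
    (hGfg : Group.FG G)
    (T : SimpleGraph V) (hT : T.IsTree) (hact : ActsOn T G) (hinv : NoInversions T G)
    (E : Set (Subgroup G)) (hE : Admissible E) (hET : IsETree T G E)
    (hmin : MinimalAction T G) (v₀ : V)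
    (Y Y' : Set (Sym2 V)) (hY : IsCylinder T G Y) (hY' : IsCylinder T G Y')
    (S S' : Set V) (hS : IsSpecialForest T S Y) (hS' : IsSpecialForest T S' Y')
    (hSi : S.Infinite) (hS'i : S'.Infinite)
    (hHS : InClassOf G Y (⨅ e ∈ cobdry T S, edgeStab G e))
    (hHS' : InClassOf G Y' (⨅ e ∈ cobdry T S', edgeStab G e))
    (hsmall : HFin (⨅ e ∈ cobdry T S, edgeStab G e) (XS G v₀ S ∩ XS G v₀ S') ∨
      HFin (⨅ e ∈ cobdry T S', edgeStab G e) (XS G v₀ S ∩ XS G v₀ S')) :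
    ∃ S₀ S₀' : Set V, IsSpecialForest T S₀ Y ∧ IsSpecialForest T S₀' Y' ∧
      (S ∆ S₀).Finite ∧ (S' ∆ S₀').Finite ∧ S₀ ∩ S₀' = ∅ := by
  classical
  have hinf : (Set.univ : Set V).Infinite := hSi.mono (Set.subset_univ _)
  have hnl := no_leaves (G := G) hT hact hmin hinf
  obtain ⟨R, hR⟩ := cocompact hGfg hT hact hmin v₀
  have hCb : (cobdry T (S ∩ S')).Finite := (hS.1.union hS'.1).subset (cobdry_inter S S')
  have hfin : (S ∩ S').Finite := by
    obtain ⟨u, N, hN⟩ : ∃ (u : V) (N : ℕ), ∀ g ∈ XS G v₀ S ∩ XS G v₀ S',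
        T.dist u (g • v₀) ≤ N := by
      rcases hsmall with h | h
      · exact bounded_of_HFin hT hact hinv v₀ hY hHS h
      · exact bounded_of_HFin hT hact hinv v₀ hY' hHS' h
    exact finite_of_orbit_bounded hT hnl v₀ hR hCb u N (fun g hg => hN g hg)
  by_cases hYY : Y = Y'
  · subst hYY
    refine ⟨S \ S', S', ⟨(hS.1.union hS'.1).subset (cobdry_diff S S'),
      (cobdry_diff S S').trans (Set.union_subset hS.2 hS'.2)⟩, hS', ?_, by simp, by simp⟩
    apply hfin.subset
    rintro x (⟨hx, hx'⟩ | ⟨hx, hx'⟩)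
    · refine ⟨hx, ?_⟩
      by_contra h
      exact hx' ⟨hx, h⟩
    · exact absurd hx.1 hx'
  · have c1 := cyl_const hT hact hinv hE hET hY hY' hYY hS
    have c2 := cyl_const hT hact hinv hE hET hY' hY (Ne.symm hYY) hS'
    rcases c1 with c1 | c1 <;> rcases c2 with c2 | c2
    · exfalso
      -- vertices of the intersection have finite valence
      have hval : ∀ x ∈ S ∩ S', (T.neighborSet x).Finite := by
        intro x hx
        have himg : ((fun w => s(x, w)) ⁻¹' cobdry T (S ∩ S')).Finite :=
          hCb.preimage (fun a _ b _ h => Sym2.congr_right.1 h)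
        apply (hfin.union himg).subset
        intro w hw
        by_cases hwC : w ∈ S ∩ S'
        · exact Or.inl hwC
        · exact Or.inr (mem_cobdry hw hx hwC)
      -- all edges at such a vertex lie in one cylinder
      have hall : ∀ x ∈ S ∩ S', x ∈ cylVerts Y → ∀ f ∈ T.edgeSet, x ∈ f → f ∈ Y := by
        rintro x hx ⟨e, he, hxe⟩ f hf hxf
        exact (hY.2.2 e he f hf).2
          (comm_of_finite_valence hact hinv (hval x hx) (hY.2.1 he) hf hxe hxf)
      obtain ⟨e', he'⟩ := hY'.1
      obtain ⟨a', ha'⟩ : ∃ a', a' ∈ e' := by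
        induction e' with
        | h a b => exact ⟨a, by simp⟩
      have ha'V : a' ∈ cylVerts Y' := ⟨e', he', ha'⟩
      have huniv : {x | x ∈ S ∧ x ∉ cylVerts Y} = Set.univ := by
        apply closed_eq_univ hT.connected
        · refine ⟨a', c1 a' ha'V, fun ha => ?_⟩
          exact cyl_disjoint hY hY' hYY e'
            (hall a' ⟨c1 a' ha'V, c2 a' ha⟩ ha e' (hY'.2.1 he') ha') he'
        · rintro z ⟨hzS, hzY⟩ x hzx
          have hxS : x ∈ S := by
            by_contra hxS
            exact hzY ⟨s(z, x), hS.2 (mem_cobdry hzx hzS hxS), by simp⟩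
          refine ⟨hxS, fun hxY => hzY ?_⟩
          exact ⟨s(z, x), hall x ⟨hxS, c2 x hxY⟩ hxY s(z, x) hzx (by simp), by simp⟩
      obtain ⟨e, he⟩ := hY.1
      obtain ⟨a, ha⟩ : ∃ a, a ∈ e := by
        induction e with
        | h a b => exact ⟨a, by simp⟩
      have : a ∈ {x | x ∈ S ∧ x ∉ cylVerts Y} := by rw [huniv]; trivial
      exact this.2 ⟨e, he, ha⟩
    · exact (case_nested hT hS hS' hSi hS'i hfin c1 c2).elim
    · exact (case_nested hT hS' hS hS'i hSi (by rwa [Set.inter_comm]) c2 c1).elim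
    · refine ⟨S, S', hS, hS', by simp, by simp, ?_⟩
      by_contra hne
      have := closed_eq_univ hT.connected (Set.nonempty_iff_ne_empty.2 hne) (by
        rintro u ⟨hu, hu'⟩ v hv
        constructor
        · by_contra hvS
          exact c2 u ⟨s(u, v), hS.2 (mem_cobdry hv hu hvS), by simp⟩ hu'
        · by_contra hvS
          exact c1 u ⟨s(u, v), hS'.2 (mem_cobdry hv hu' hvS), by simp⟩ hu)
      rw [this] at hfin
      exact hinf hfin

end SSRN
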